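/- Let H be a complex Hilbert space with dim H > 2k > 2. If f : G_k(H) → G_k(H) is orthogonality preserving and adjacency preserving, then f is ortho-adjacency preserving: whenever X and Y are adjacent and compatible, f(X) and f(Y) are adjacent and compatible. -/

import Mathlib

def Compatible {H : Type*} [NormedAddCommGroup H] [InnerProductSpace ℂ H]
    (X Y : Submodule ℂ H) : Prop :=
  ∃ X' Y' Z : Submodule ℂ H, X' ⟂ Y' ∧ X' ⟂ Z ∧ Y' ⟂ Z ∧ X = X' ⊔ Z ∧ Y = Y' ⊔ Z

theorem aux_sup_span {H : Type*} [NormedAddCommGroup H] [InnerProductSpace ℂ H]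
    (A : Submodule ℂ H) [FiniteDimensional ℂ A] (x : H) (hx : x ∉ A) :
    Module.finrank ℂ ↥(A ⊔ Submodule.span ℂ {x}) = Module.finrank ℂ A + 1 := by
  have hx0 : x ≠ 0 := fun h => hx (h ▸ A.zero_mem)
  have h := Submodule.finrank_sup_add_finrank_inf_eq A (Submodule.span ℂ {x})
  have hd : A ⊓ Submodule.span ℂ {x} = ⊥ :=
    disjoint_iff.1 ((Submodule.disjoint_span_singleton' hx0).2 hx)
  rw [hd, finrank_bot, finrank_span_singleton hx0] at h
  omega

theorem aux_between {H : Type*} [NormedAddCommGroup H] [InnerProductSpace ℂ H]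
    (A B : Submodule ℂ H) [FiniteDimensional ℂ A] (hAB : A ≤ B) (n : ℕ)
    (hB : ∀ C : Submodule ℂ H, FiniteDimensional ℂ C →
      Module.finrank ℂ C < Module.finrank ℂ A + n → C ≠ B) :
    ∃ C : Submodule ℂ H, A ≤ C ∧ C ≤ B ∧ FiniteDimensional ℂ C ∧
      Module.finrank ℂ C = Module.finrank ℂ A + n := by
  induction n with
  | zero => exact ⟨A, le_rfl, hAB, inferInstance, rfl⟩
  | succ n ih =>
    obtain ⟨C, h1, h2, h3, h4⟩ := ih (fun C hC h => hB C hC (by omega))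
    have hne := hB C h3 (by omega)
    obtain ⟨x, hxB, hxC⟩ := SetLike.exists_of_lt (lt_of_le_of_ne h2 hne)
    refine ⟨C ⊔ Submodule.span ℂ {x}, h1.trans le_sup_left,
      sup_le h2 ((Submodule.span_singleton_le_iff_mem _ _).2 hxB), inferInstance, ?_⟩
    rw [aux_sup_span C x hxC]; omega

theorem aux_dist {H : Type*} [NormedAddCommGroup H] [InnerProductSpace ℂ H]
    {k : ℕ} (hk : 2 < 2 * k)
    (f : {X : Submodule ℂ H // Module.finrank ℂ ↥X = k} →
         {X : Submodule ℂ H // Module.finrank ℂ ↥X = k})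
    (hadj : ∀ X Y : {X : Submodule ℂ H // Module.finrank ℂ ↥X = k},
      Module.finrank ℂ ↥(X.1 ⊓ Y.1) = k - 1 →
      Module.finrank ℂ ↥((f X).1 ⊓ (f Y).1) = k - 1)
    (X : {X : Submodule ℂ H // Module.finrank ℂ ↥X = k}) (n : ℕ) :
    ∀ Y : {X : Submodule ℂ H // Module.finrank ℂ ↥X = k},
      k ≤ Module.finrank ℂ ↥(X.1 ⊓ Y.1) + n →
      k ≤ Module.finrank ℂ ↥((f X).1 ⊓ (f Y).1) + n := by
  have fd : ∀ Y : {X : Submodule ℂ H // Module.finrank ℂ ↥X = k}, FiniteDimensional ℂ Y.1 :=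
    fun Y => FiniteDimensional.of_finrank_pos (by rw [Y.2]; omega)
  induction n with
  | zero =>
    intro Y h
    have := fd X
    have := fd Y
    have e1 : X.1 ⊓ Y.1 = X.1 :=
      Submodule.eq_of_le_of_finrank_le inf_le_left (by rw [X.2]; omega)
    have e2 : X.1 ⊓ Y.1 = Y.1 :=
      Submodule.eq_of_le_of_finrank_le inf_le_right (by rw [Y.2]; omega)
    have e : X = Y := Subtype.ext (e1.symm.trans e2)
    subst e
    rw [inf_idem, (f X).2]; omega
  | succ n ih =>
    intro Y h
    by_cases hc : k ≤ Module.finrank ℂ ↥(X.1 ⊓ Y.1) + n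
    · have := ih Y hc
      omega
    have := fd X
    have := fd Y
    have hlt : Module.finrank ℂ ↥(X.1 ⊓ Y.1) < k := by omega
    obtain ⟨W, hW1, hW2, hW3, hW4⟩ := aux_between (X.1 ⊓ Y.1) Y.1 inf_le_right
      (k - 1 - Module.finrank ℂ ↥(X.1 ⊓ Y.1)) (by
        rintro C hC hC' rfl
        rw [Y.2] at hC'; omega)
    have hXY : ¬ X.1 ≤ Y.1 := by
      intro hle
      rw [inf_eq_left.2 hle, X.2] at hlt
      omega
    obtain ⟨x, hxX, hxY⟩ := SetLike.not_le_iff_exists.1 hXY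
    have hxW : x ∉ W := fun h => hxY (hW2 h)
    have hV := aux_sup_span W x hxW
    let V : {X : Submodule ℂ H // Module.finrank ℂ ↥X = k} :=
      ⟨W ⊔ Submodule.span ℂ {x}, by omega⟩
    have hxV : x ∈ V.1 := Submodule.mem_sup_right (Submodule.mem_span_singleton_self x)
    have := fd V
    have hVY : Module.finrank ℂ ↥(V.1 ⊓ Y.1) = k - 1 := by
      have h1 : Module.finrank ℂ W ≤ Module.finrank ℂ ↥(V.1 ⊓ Y.1) :=
        Submodule.finrank_mono (le_inf le_sup_left hW2)
      have h2 : V.1 ⊓ Y.1 < V.1 :=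
        lt_of_le_of_ne inf_le_left (fun h => hxY (inf_eq_left.1 h hxV))
      have h3 := Submodule.finrank_lt_finrank_of_lt h2
      rw [V.2] at h3
      omega
    have hXV : Module.finrank ℂ ↥(X.1 ⊓ Y.1) + 1 ≤ Module.finrank ℂ ↥(X.1 ⊓ V.1) := by
      rw [← aux_sup_span (X.1 ⊓ Y.1) x (fun h => hxY h.2)]
      apply Submodule.finrank_mono
      refine sup_le (le_inf inf_le_left (hW1.trans le_sup_left)) ?_
      rw [Submodule.span_singleton_le_iff_mem]
      exact ⟨hxX, hxV⟩
    have i1 := ih V (by omega)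
    have i2 := hadj V Y hVY
    have := fd (f X)
    have := fd (f Y)
    have := fd (f V)
    have s := Submodule.finrank_sup_add_finrank_inf_eq ((f X).1 ⊓ (f V).1) ((f V).1 ⊓ (f Y).1)
    have s1 : Module.finrank ℂ ↥(((f X).1 ⊓ (f V).1) ⊔ ((f V).1 ⊓ (f Y).1)) ≤ k := by
      refine le_of_le_of_eq (Submodule.finrank_mono (t := (f V).1) ?_) (f V).2
      exact sup_le inf_le_right inf_le_left
    have s2 : Module.finrank ℂ ↥(((f X).1 ⊓ (f V).1) ⊓ ((f V).1 ⊓ (f Y).1)) ≤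
        Module.finrank ℂ ↥((f X).1 ⊓ (f Y).1) :=
      Submodule.finrank_mono (le_inf (inf_le_left.trans inf_le_left)
        (inf_le_right.trans inf_le_right))
    omega

theorem aux_half {H : Type*} [NormedAddCommGroup H] [InnerProductSpace ℂ H]
    {k : ℕ} (hk : 2 < 2 * k)
    (f : {X : Submodule ℂ H // Module.finrank ℂ ↥X = k} →
         {X : Submodule ℂ H // Module.finrank ℂ ↥X = k})
    (horth : ∀ X Y, X.1 ⟂ Y.1 → (f X).1 ⟂ (f Y).1)
    (hadj : ∀ X Y : {X : Submodule ℂ H // Module.finrank ℂ ↥X = k},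
      Module.finrank ℂ ↥(X.1 ⊓ Y.1) = k - 1 →
      Module.finrank ℂ ↥((f X).1 ⊓ (f Y).1) = k - 1)
    (X Y : {X : Submodule ℂ H // Module.finrank ℂ ↥X = k})
    (hXY : Module.finrank ℂ ↥(X.1 ⊓ Y.1) = k - 1)
    (N : Submodule ℂ H) [FiniteDimensional ℂ N] (hN : Module.finrank ℂ N = k - 1)
    (hNX : N ⟂ X.1) (hNY : N ⟂ Y.1)
    (X' : Submodule ℂ H) (hX' : X' ≤ X.1) (hX'Y : X' ⟂ Y.1) (hX0 : X' ≠ ⊥) :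
    ∃ L : Submodule ℂ H, L ⟂ (f Y).1 ∧ L ≤ (f X).1 ∧ (f X).1 = L ⊔ ((f X).1 ⊓ (f Y).1) := by
  have fd : ∀ Y : {X : Submodule ℂ H // Module.finrank ℂ ↥X = k}, FiniteDimensional ℂ Y.1 :=
    fun Y => FiniteDimensional.of_finrank_pos (by rw [Y.2]; omega)
  obtain ⟨x, hx, hx0⟩ := Submodule.exists_mem_ne_zero_of_ne_bot hX0
  have hxN : x ∉ N := fun h => hx0 (by
    have := (hNX.inner_eq h (hX' hx))
    simpa using this)
  let V : {X : Submodule ℂ H // Module.finrank ℂ ↥X = k} :=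
    ⟨N ⊔ Submodule.span ℂ {x}, by rw [aux_sup_span N x hxN]; omega⟩
  have hVY : V.1 ⟂ Y.1 := by
    refine Submodule.isOrtho_sup_left.2 ⟨hNY, ?_⟩
    exact hX'Y.mono_left ((Submodule.span_singleton_le_iff_mem _ _).2 hx)
  have := fd X
  have hpos : 1 ≤ Module.finrank ℂ ↥(X.1 ⊓ V.1) := by
    rw [Submodule.one_le_finrank_iff]
    refine (Submodule.ne_bot_iff _).2 ⟨x, ⟨hX' hx, ?_⟩, hx0⟩
    exact Submodule.mem_sup_right (Submodule.mem_span_singleton_self x)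
  have h1 := aux_dist hk f hadj X (k - 1) V (by omega)
  have := fd (f X)
  have h2 : 1 ≤ Module.finrank ℂ ↥((f X).1 ⊓ (f V).1) := by omega
  rw [Submodule.one_le_finrank_iff] at h2
  obtain ⟨l, hl, hl0⟩ := Submodule.exists_mem_ne_zero_of_ne_bot h2
  have hlle : Submodule.span ℂ {l} ≤ (f X).1 := (Submodule.span_singleton_le_iff_mem _ _).2 hl.1
  have ho : Submodule.span ℂ {l} ⟂ (f Y).1 :=
    (horth V Y hVY).mono_left ((Submodule.span_singleton_le_iff_mem _ _).2 hl.2)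
  refine ⟨Submodule.span ℂ {l}, ho, hlle, ?_⟩
  have hn : l ∉ (f X).1 ⊓ (f Y).1 := fun h => hl0 (by
    have := ho.inner_eq (Submodule.mem_span_singleton_self l) h.2
    simpa using this)
  symm
  apply Submodule.eq_of_le_of_finrank_le (sup_le hlle inf_le_left)
  rw [sup_comm, aux_sup_span _ _ hn, hadj X Y hXY, (f X).2]
  omega

theorem stmt_15 {H : Type*} [NormedAddCommGroup H] [InnerProductSpace ℂ H] [CompleteSpace H]
    {k : ℕ} (hk : 2 < 2 * k) (hdim : (2 * k : Cardinal) < Module.rank ℂ H)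
    (f : {X : Submodule ℂ H // Module.finrank ℂ ↥X = k} →
         {X : Submodule ℂ H // Module.finrank ℂ ↥X = k})
    (horth : ∀ X Y, X.1 ⟂ Y.1 → (f X).1 ⟂ (f Y).1)
    (hadj : ∀ X Y : {X : Submodule ℂ H // Module.finrank ℂ ↥X = k},
      Module.finrank ℂ ↥(X.1 ⊓ Y.1) = k - 1 →
      Module.finrank ℂ ↥((f X).1 ⊓ (f Y).1) = k - 1) :
    ∀ X Y : {X : Submodule ℂ H // Module.finrank ℂ ↥X = k},
      Module.finrank ℂ ↥(X.1 ⊓ Y.1) = k - 1 → Compatible X.1 Y.1 →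
      Module.finrank ℂ ↥((f X).1 ⊓ (f Y).1) = k - 1 ∧ Compatible (f X).1 (f Y).1 := by
  intro X Y hXY hc
  refine ⟨hadj X Y hXY, ?_⟩
  have fd : ∀ Y : {X : Submodule ℂ H // Module.finrank ℂ ↥X = k}, FiniteDimensional ℂ Y.1 :=
    fun Y => FiniteDimensional.of_finrank_pos (by rw [Y.2]; omega)
  have := fd X
  have := fd Y
  obtain ⟨X', Y', Z, h1, h2, h3, hX, hY⟩ := hc
  have hX'0 : X' ≠ ⊥ := by
    rintro rfl
    have : X.1 ⊓ Y.1 = X.1 := inf_eq_left.2 (by rw [hX, hY, bot_sup_eq]; exact le_sup_right)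
    rw [this, X.2] at hXY
    omega
  have hY'0 : Y' ≠ ⊥ := by
    rintro rfl
    have : X.1 ⊓ Y.1 = Y.1 := inf_eq_right.2 (by rw [hX, hY, bot_sup_eq]; exact le_sup_right)
    rw [this, Y.2] at hXY
    omega
  have hs := Submodule.finrank_sup_add_finrank_inf_eq X.1 Y.1
  rw [hXY, X.2, Y.2] at hs
  obtain ⟨N, -, hNB, hNfd, hN⟩ := aux_between (⊥ : Submodule ℂ H) (X.1 ⊔ Y.1)ᗮ bot_le (k - 1) (by
    rintro C hC hlt rfl
    rw [finrank_bot] at hlt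
    have htop := Submodule.sup_orthogonal_of_hasOrthogonalProjection (K := X.1 ⊔ Y.1)
    have hle := Submodule.finrank_add_le_finrank_add_finrank (X.1 ⊔ Y.1) (X.1 ⊔ Y.1)ᗮ
    have hfd : FiniteDimensional ℂ ↥((X.1 ⊔ Y.1) ⊔ (X.1 ⊔ Y.1)ᗮ) := inferInstance
    rw [htop] at hle hfd
    have e := Module.finrank_eq_rank ℂ (⊤ : Submodule ℂ H)
    rw [rank_top] at e
    rw [← e] at hdim
    have : 2 * k < Module.finrank ℂ (⊤ : Submodule ℂ H) := by exact_mod_cast hdim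
    omega)
  rw [finrank_bot, zero_add] at hN
  have hNX : N ⟂ X.1 := ((Submodule.isOrtho_iff_le).2 hNB).mono_right le_sup_left
  have hNY : N ⟂ Y.1 := ((Submodule.isOrtho_iff_le).2 hNB).mono_right le_sup_right
  obtain ⟨L, hL1, hL2, hL3⟩ := aux_half hk f horth hadj X Y hXY N hN hNX hNY X'
    (by rw [hX]; exact le_sup_left) (by rw [hY]; exact Submodule.isOrtho_sup_right.2 ⟨h1, h2⟩) hX'0
  obtain ⟨M, hM1, hM2, hM3⟩ := aux_half hk f horth hadj Y X (by rw [inf_comm]; exact hXY)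
    N hN hNY hNX Y' (by rw [hY]; exact le_sup_left)
    (by rw [hX]; exact Submodule.isOrtho_sup_right.2 ⟨h1.symm, h3⟩) hY'0
  exact ⟨L, M, (f X).1 ⊓ (f Y).1, hL1.mono_right hM2, hL1.mono_right inf_le_right,
    hM1.mono_right inf_le_left, hL3, by rw [inf_comm]; exact hM3⟩
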